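/- Let (X,d) be a metric space with marked point p. If every pretangent space Ω_{p,r̃}^X is a geodesic metric space whose metric ρ satisfies the quadrilateral inequality ρ²(α,γ)+ρ²(β,η) ≤ ρ²(α,β)+ρ²(β,γ)+ρ²(γ,η)+ρ²(η,α) for all α,β,γ,η (i.e., every pretangent space is CAT(0)), then X is midpoint convex at p and liminf_{w,x,y,z→p} A₁(w,x,y,z) ≥ 0. -/

import Mathlib

open Filter Topology

universe u

section Defs

variable {X : Type u} [MetricSpace X]

/-- A normalizing sequence is a sequence of positive reals tending to zero. -/
def IsNormalizingSeq (r : ℕ → ℝ) : Prop :=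
  (∀ n, 0 < r n) ∧ Tendsto r atTop (𝓝 0)

/-- Two sequences of points of `X` are mutually stable w.r.t. `r` if
`d(x_n, y_n)/r_n` converges to a finite limit. -/
def MutuallyStable (r : ℕ → ℝ) (x y : ℕ → X) : Prop :=
  ∃ L : ℝ, Tendsto (fun n => dist (x n) (y n) / r n) atTop (𝓝 L)

/-- A family of sequences is self-stable if any two members are mutually stable. -/
def SelfStable (r : ℕ → ℝ) (F : Set (ℕ → X)) : Prop :=
  ∀ x ∈ F, ∀ y ∈ F, MutuallyStable r x y

/-- A maximal self-stable family containing the constant sequence `p`. -/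
def MaximalSelfStable (p : X) (r : ℕ → ℝ) (F : Set (ℕ → X)) : Prop :=
  SelfStable r F ∧ (fun _ => p) ∈ F ∧
    ∀ G : Set (ℕ → X), SelfStable r G → F ⊆ G → G = F

/-- `(Ω, π)` is (a realization of) the pretangent space of `X` at `p`
with respect to the normalizing sequence `r` and the maximal self-stable family
`F`; the map `π` is the metric identification projection, so that the distance
in `Ω` between `π x` and `π y` is `lim_n d(x_n,y_n)/r_n`. -/
def IsPretangentSpace (p : X) (r : ℕ → ℝ) (F : Set (ℕ → X))
    {Ω : Type u} [MetricSpace Ω] (π : (ℕ → X) → Ω) : Prop :=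
  IsNormalizingSeq r ∧ MaximalSelfStable p r F ∧
    (∀ ω : Ω, ∃ x ∈ F, π x = ω) ∧
    ∀ x ∈ F, ∀ y ∈ F,
      Tendsto (fun n => dist (x n) (y n) / r n) atTop (𝓝 (dist (π x) (π y)))

/-- The pretangent space determined by the maximal self-stable family `F` is
tangent: for every strictly increasing sequence `φ` of naturals and every
maximal self-stable family `F'` w.r.t. `r ∘ φ` containing all `x ∘ φ` with
`x ∈ F`, the canonical isometric embedding `em'` is bijective (being always an
isometric embedding it suffices that it be surjective, as stated here). -/
def IsTangentFamily (p : X) (r : ℕ → ℝ) (F : Set (ℕ → X)) : Prop :=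
  ∀ φ : ℕ → ℕ, StrictMono φ →
    ∀ F' : Set (ℕ → X), MaximalSelfStable p (r ∘ φ) F' →
      (∀ x ∈ F, x ∘ φ ∈ F') →
      ∀ y ∈ F', ∃ x ∈ F,
        Tendsto (fun k => dist (x (φ k)) (y k) / r (φ k)) atTop (𝓝 0)

/-- `δ_p(w,x,y,z) = max_i d(x_i, p)`. -/
noncomputable def delta4 (p w x y z : X) : ℝ :=
  max (dist w p) (max (dist x p) (max (dist y p) (dist z p)))

/-- `δ_p(x,y,z) = max_i d(x_i, p)`. -/
noncomputable def delta3 (p x y z : X) : ℝ :=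
  max (dist x p) (max (dist y p) (dist z p))

open Classical in
/-- The function `A₁` of Berg–Nikolaev type. -/
noncomputable def A1 (p w x y z : X) : ℝ :=
  if w = p ∧ x = p ∧ y = p ∧ z = p then 0
  else (dist w x ^ 2 + dist x y ^ 2 + dist y z ^ 2 + dist z w ^ 2
          - dist w y ^ 2 - dist x z ^ 2) / delta4 p w x y z ^ 2

open Classical in
/-- The function `A₂` of Lebedeva–Petrunin type. -/
noncomputable def A2 (p w x y z : X) : ℝ :=
  if w = p ∧ x = p ∧ y = p ∧ z = p then 0
  else (dist w x ^ 2 + dist w y ^ 2 + dist w z ^ 2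
          - (dist x y ^ 2 + dist y z ^ 2 + dist z x ^ 2) / 3) / delta4 p w x y z ^ 2

open Classical in
/-- The function `A₃` of Ptolemy type. -/
noncomputable def A3 (p w x y z : X) : ℝ :=
  if w = p ∧ x = p ∧ y = p ∧ z = p then 0
  else (dist x w * dist y z + dist x z * dist y w - dist x y * dist w z)
          / delta4 p w x y z ^ 2

open Classical in
/-- The quotient `|d(w,z) - d(x,y)/2| / δ_p(x,y)`, valued in `EReal`, with the
conventions: `0` if `x = y = p` and `z = p`, and `+∞` if `x = y = p` but `z ≠ p`. -/
noncomputable def midQuot (p w x y z : X) : EReal :=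
  if x = p ∧ y = p then (if z = p then (0 : EReal) else ⊤)
  else ((|dist w z - dist x y / 2| / max (dist x p) (dist y p) : ℝ) : EReal)

/-- `z` is an infinitesimal midpoint of the sequences `x` and `y`. -/
def IsInfinitesimalMidpoint (p : X) (x y z : ℕ → X) : Prop :=
  Tendsto (fun n => midQuot p (x n) (x n) (y n) (z n)) atTop (𝓝 (0 : EReal)) ∧
    Tendsto (fun n => midQuot p (y n) (x n) (y n) (z n)) atTop (𝓝 (0 : EReal))

/-- `X` is midpoint convex at the marked point `p`. -/
def MidpointConvexAt (p : X) : Prop :=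
  ∀ x y : ℕ → X, Tendsto x atTop (𝓝 p) → Tendsto y atTop (𝓝 p) →
    ∃ z : ℕ → X, IsInfinitesimalMidpoint p x y z

/-- `X` is Busemann convex at the marked point `p`. -/
def BusemannConvexAt (p : X) : Prop :=
  MidpointConvexAt p ∧
    ∀ x0 x1 y m : ℕ → X, Tendsto x0 atTop (𝓝 p) → Tendsto x1 atTop (𝓝 p) →
      Tendsto y atTop (𝓝 p) → IsInfinitesimalMidpoint p x0 x1 m →
      Tendsto (fun n =>
          max (dist (m n) (y n) - (dist (x0 n) (y n) + dist (x1 n) (y n)) / 2) 0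
            / delta3 p (x0 n) (y n) (x1 n)) atTop (𝓝 (0 : ℝ))

end Defs

section MetricDefs

/-- `s` is a geodesic segment with endpoints `x` and `y`: a subset isometric to
the closed interval `[0, d(x,y)]`, the endpoints of the interval corresponding
to `x` and `y`. -/
def IsGeodesicSegment {Z : Type u} [MetricSpace Z] (s : Set Z) (x y : Z) : Prop :=
  ∃ f : ℝ → Z,
    (∀ a ∈ Set.Icc 0 (dist x y), ∀ b ∈ Set.Icc 0 (dist x y),
      dist (f a) (f b) = |a - b|) ∧
    f '' Set.Icc 0 (dist x y) = s ∧ f 0 = x ∧ f (dist x y) = y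

/-- A metric space is geodesic if any two points are the endpoints of some
geodesic segment. -/
def IsGeodesicSpace (Y : Type u) [MetricSpace Y] : Prop :=
  ∀ x y : Y, ∃ s : Set Y, IsGeodesicSegment s x y

/-- `m` is a midpoint of `x` and `y`. -/
def IsMidpointOf {Z : Type u} [MetricSpace Z] (m x y : Z) : Prop :=
  dist m x = dist x y / 2 ∧ dist m y = dist x y / 2

/-- An affinely parametrized geodesic `γ : [a,b] → Z`:
`d(γ s, γ t) = λ |s - t|` for some constant `λ ≥ 0`. -/
def IsAffineGeodesic {Z : Type u} [MetricSpace Z] (γ : ℝ → Z) (a b : ℝ) : Prop :=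
  ∃ lam : ℝ, 0 ≤ lam ∧ ∀ s ∈ Set.Icc a b, ∀ t ∈ Set.Icc a b,
    dist (γ s) (γ t) = lam * |s - t|

/-- Busemann convexity of a (geodesic) metric space: for any two affinely
parametrized geodesics the joint distance function is convex. -/
def BusemannConvex (Y : Type u) [MetricSpace Y] : Prop :=
  ∀ (a b a' b' : ℝ) (γ γ' : ℝ → Y), IsAffineGeodesic γ a b →
    IsAffineGeodesic γ' a' b' →
    ConvexOn ℝ (Set.Icc a b ×ˢ Set.Icc a' b')
      (fun q : ℝ × ℝ => dist (γ q.1) (γ' q.2))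

/-- A metric space is Ptolemaic if the Ptolemy inequality holds. -/
def Ptolemaic (Y : Type u) [MetricSpace Y] : Prop :=
  ∀ x y u v : Y, dist x y * dist u v ≤ dist x u * dist y v + dist x v * dist y u

end MetricDefs

section Helpers

theorem exists_maximalSelfStable {X : Type u} [MetricSpace X] (p : X) (r : ℕ → ℝ)
    (S : Set (ℕ → X)) (hS : SelfStable r S) (hp : (fun _ => p) ∈ S) :
    ∃ F, S ⊆ F ∧ MaximalSelfStable p r F := by
  obtain ⟨F, hSF, hF⟩ := zorn_subset_nonempty {G : Set (ℕ → X) | SelfStable r G} (by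
    intro c hc hchain hne
    refine ⟨⋃₀ c, ?_, fun s hs => Set.subset_sUnion_of_mem hs⟩
    rintro x ⟨A, hA, hx⟩ y ⟨B, hB, hy⟩
    rcases hchain.total hA hB with hAB | hBA
    · exact hc hB x (hAB hx) y hy
    · exact hc hA x hx y (hBA hy)) S hS
  refine ⟨F, hSF, hF.prop, hSF hp, fun G hG hFG => ?_⟩
  exact Set.Subset.antisymm (hF.le_of_ge hG hFG) hFG

theorem exists_metric_quotient {α : Type u} (D : α → α → ℝ) (h0 : ∀ x, D x x = 0)
    (hc : ∀ x y, D x y = D y x) (ht : ∀ x y z, D x z ≤ D x y + D y z) :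
    ∃ (Ω : Type u) (_ : MetricSpace Ω) (g : α → Ω), Function.Surjective g ∧
      ∀ x y, dist (g x) (g y) = D x y := by
  letI P : PseudoMetricSpace α :=
    { dist := D
      dist_self := h0
      dist_comm := hc
      dist_triangle := ht }
  exact ⟨SeparationQuotient α, inferInstance, SeparationQuotient.mk,
    SeparationQuotient.surjective_mk, fun x y => SeparationQuotient.dist_mk x y⟩

theorem exists_pretangent {X : Type u} [MetricSpace X] (p : X) (r : ℕ → ℝ)
    (hr : IsNormalizingSeq r) (F : Set (ℕ → X)) (hF : MaximalSelfStable p r F) :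
    ∃ (Ω : Type u) (_ : MetricSpace Ω) (π : (ℕ → X) → Ω), IsPretangentSpace p r F π := by
  classical
  have hst : ∀ x y : F, ∃ L : ℝ,
      Tendsto (fun n => dist (x.1 n) (y.1 n) / r n) atTop (𝓝 L) :=
    fun x y => hF.1 x.1 x.2 y.1 y.2
  choose D hD using hst
  obtain ⟨Ω, iΩ, g, hg, hgD⟩ := exists_metric_quotient D
    (fun x => by
      refine tendsto_nhds_unique (hD x x) ?_
      simp)
    (fun x y => by
      refine tendsto_nhds_unique (hD x y) ?_
      simpa only [dist_comm] using hD y x)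
    (fun x y z => by
      refine le_of_tendsto_of_tendsto' (hD x z) ((hD x y).add (hD y z)) fun n => ?_
      rw [← add_div]
      exact div_le_div_of_nonneg_right (dist_triangle _ _ _) (hr.1 n).le)
  let p0 : F := ⟨fun _ => p, hF.2.1⟩
  let π : (ℕ → X) → Ω := fun x =>
    if hx : x ∈ F then g ⟨x, hx⟩ else g p0
  refine ⟨Ω, iΩ, π, hr, hF, ?_, ?_⟩
  · intro ω
    obtain ⟨⟨x, hx⟩, rfl⟩ := hg ω
    exact ⟨x, hx, by simp [π, hx]⟩
  · intro x hx y hy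
    have : dist (π x) (π y) = D ⟨x, hx⟩ ⟨y, hy⟩ := by
      simp only [π, hx, hy, dif_pos]
      rw [hgD]
    rw [this]
    exact hD ⟨x, hx⟩ ⟨y, hy⟩

theorem key_subseq {X : Type u} [MetricSpace X] (p : X) (q : Fin 5 → ℕ → X)
    (hq : q 4 = fun _ => p) (r : ℕ → ℝ) (hr : IsNormalizingSeq r)
    (hb : ∀ i n, dist (q i n) p ≤ r n) :
    ∃ (φ : ℕ → ℕ) (F : Set (ℕ → X)) (Ω : Type u) (_ : MetricSpace Ω) (π : (ℕ → X) → Ω),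
      StrictMono φ ∧ IsPretangentSpace p (r ∘ φ) F π ∧ ∀ i, q i ∘ φ ∈ F := by
  let u : ℕ → Fin 5 → Fin 5 → ℝ := fun n i j => dist (q i n) (q j n) / r n
  have hK : IsCompact (Set.univ.pi fun _ : Fin 5 => Set.univ.pi fun _ : Fin 5 =>
      Set.Icc (0 : ℝ) 2) :=
    isCompact_univ_pi fun _ => isCompact_univ_pi fun _ => isCompact_Icc
  obtain ⟨L, -, φ, hφ, hL⟩ := hK.tendsto_subseq (x := u) (by
    intro n i _ j _
    refine ⟨div_nonneg dist_nonneg (hr.1 n).le, ?_⟩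
    rw [div_le_iff₀ (hr.1 n)]
    have := dist_triangle_right (q i n) (q j n) p
    linarith [hb i n, hb j n])
  have hrφ : IsNormalizingSeq (r ∘ φ) :=
    ⟨fun n => hr.1 _, hr.2.comp hφ.tendsto_atTop⟩
  obtain ⟨F, hSF, hF⟩ := exists_maximalSelfStable p (r ∘ φ) (Set.range fun i => q i ∘ φ)
    (by
      rintro _ ⟨i, rfl⟩ _ ⟨j, rfl⟩
      exact ⟨L i j, tendsto_pi_nhds.1 (tendsto_pi_nhds.1 hL i) j⟩)
    ⟨4, by simp [hq]; rfl⟩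
  obtain ⟨Ω, i, π, hπ⟩ := exists_pretangent p _ hrφ F hF
  exact ⟨φ, F, Ω, i, π, hφ, hπ, fun i => hSF ⟨i, rfl⟩⟩

end Helpers

/-- if every pretangent space is a geodesic space satisfying the
quadrilateral inequality (i.e. is CAT(0)), then `X` is midpoint convex at `p`
and `liminf_{w,x,y,z → p} A₁ ≥ 0`. -/
theorem midpointConvex_and_liminf_A1_of_pretangent_CAT0
    {X : Type u} [MetricSpace X] (p : X)
    (h : ∀ (r : ℕ → ℝ) (F : Set (ℕ → X)) (Ω : Type u) [MetricSpace Ω]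
      (π : (ℕ → X) → Ω), IsPretangentSpace p r F π →
      IsGeodesicSpace Ω ∧
        ∀ α β γ η : Ω, dist α γ ^ 2 + dist β η ^ 2 ≤
          dist α β ^ 2 + dist β γ ^ 2 + dist γ η ^ 2 + dist η α ^ 2) :
    MidpointConvexAt p ∧
      0 ≤ liminf (fun q : X × X × X × X => A1 p q.1 q.2.1 q.2.2.1 q.2.2.2)
          (𝓝 (p, p, p, p)) := by
  constructor
  · intro x y hx hy
    set δ : ℕ → ℝ := fun n => max (dist (x n) p) (dist (y n) p) with hδ
    have hδ0 : ∀ n, 0 ≤ δ n := fun n => le_max_of_le_left dist_nonneg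
    have hδt : Tendsto δ atTop (𝓝 0) := by
      simpa using (tendsto_iff_dist_tendsto_zero.1 hx).max (tendsto_iff_dist_tendsto_zero.1 hy)
    have hδz : ∀ n, δ n = 0 → x n = p ∧ y n = p := by
      intro n hn
      have h1 : dist (x n) p ≤ δ n := le_max_left _ _
      have h2 : dist (y n) p ≤ δ n := le_max_right _ _
      rw [hn] at h1 h2
      exact ⟨dist_le_zero.1 h1, dist_le_zero.1 h2⟩
    let e : ℕ → X → ℝ := fun n z => |dist (x n) z - dist (x n) (y n) / 2| / δ n +
      |dist (y n) z - dist (x n) (y n) / 2| / δ n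
    have he0 : ∀ n z, 0 ≤ e n z := fun n z => by
      have := hδ0 n
      positivity
    have hmain : ∀ ε > 0, ∀ᶠ n in atTop, ∃ z, e n z < ε := by
      intro ε hε
      by_contra hcon
      rw [not_eventually] at hcon
      obtain ⟨ψ, hψ, hψe⟩ := extraction_of_frequently_atTop hcon
      push Not at hψe
      have hpos : ∀ n, 0 < δ (ψ n) := by
        intro n
        refine lt_of_le_of_ne (hδ0 _) fun h0 => ?_
        have := hψe n p
        simp only [e, ← h0, div_zero, add_zero] at this
        linarith
      obtain ⟨φ, F, Ω, iΩ, π, hφ, hπ, hmem⟩ := key_subseq p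
        ![x ∘ ψ, y ∘ ψ, x ∘ ψ, y ∘ ψ, fun _ => p] rfl (δ ∘ ψ)
        ⟨hpos, hδt.comp hψ.tendsto_atTop⟩ (by
          intro i n
          fin_cases i
          · exact le_max_left _ _
          · exact le_max_right _ _
          · exact le_max_left _ _
          · exact le_max_right _ _
          · simpa using (hpos n).le)
      obtain ⟨s, f, hf, -, hf0, hf1⟩ := (h _ _ _ _ hπ).1 (π (x ∘ ψ ∘ φ)) (π (y ∘ ψ ∘ φ))
      set D := dist (π (x ∘ ψ ∘ φ)) (π (y ∘ ψ ∘ φ)) with hD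
      have hD0 : 0 ≤ D := dist_nonneg
      obtain ⟨m, hm, hmf⟩ := hπ.2.2.1 (f (D / 2))
      have hxF : x ∘ ψ ∘ φ ∈ F := hmem 0
      have hyF : y ∘ ψ ∘ φ ∈ F := hmem 1
      have t1 := hπ.2.2.2 _ hxF _ hm
      have t2 := hπ.2.2.2 _ hyF _ hm
      have t3 := hπ.2.2.2 _ hxF _ hyF
      have hA : (0 : ℝ) ∈ Set.Icc 0 D := ⟨le_rfl, hD0⟩
      have hB : D ∈ Set.Icc 0 D := ⟨hD0, le_rfl⟩
      have hC : D / 2 ∈ Set.Icc 0 D := ⟨by linarith, by linarith⟩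
      have d1 : dist (π (x ∘ ψ ∘ φ)) (π m) = D / 2 := by
        rw [hmf, ← hf0, hf _ hA _ hC, zero_sub, abs_neg, abs_of_nonneg (by linarith)]
      have d2 : dist (π (y ∘ ψ ∘ φ)) (π m) = D / 2 := by
        rw [hmf, ← hf1, hf _ hB _ hC, abs_of_nonneg (by linarith)]
        ring
      rw [d1] at t1
      rw [d2] at t2
      rw [← hD] at t3
      have T := ((t1.sub (t3.div_const 2)).abs).add ((t2.sub (t3.div_const 2)).abs)
      simp only [sub_self, abs_zero, add_zero] at T
      obtain ⟨n, hn⟩ := (T.eventually (gt_mem_nhds hε)).exists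
      have hp := hpos (φ n)
      have := hψe (φ n) (m n)
      simp only [e] at this
      simp only [Function.comp] at hn
      have key : ∀ a b c : ℝ, 0 < c → |a / c - b / c / 2| = |a - b / 2| / c := by
        intro a b c hc
        rw [← abs_of_pos hc, ← abs_div, abs_of_pos hc]
        congr 1
        field_simp
      rw [key _ _ _ hp, key _ _ _ hp] at hn
      linarith
    have hbdd : ∀ n, BddBelow (Set.range (e n)) := fun n =>
      ⟨0, by rintro _ ⟨z, rfl⟩; exact he0 n z⟩
    have hch : ∀ n : ℕ, ∃ z, (δ n = 0 → z = p) ∧ e n z < (⨅ z, e n z) + 1 / ((n : ℝ) + 1) := by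
      intro n
      have hn : (0 : ℝ) < 1 / ((n : ℝ) + 1) := by positivity
      have : Nonempty X := ⟨p⟩
      by_cases h0 : δ n = 0
      · refine ⟨p, fun _ => rfl, ?_⟩
        have : 0 ≤ ⨅ z, e n z := le_ciInf (he0 n)
        have h1 : e n p = 0 := by simp [e, h0]
        rw [h1]
        linarith
      · obtain ⟨z, hz⟩ := exists_lt_of_ciInf_lt (lt_add_of_pos_right (⨅ z, e n z) hn)
        exact ⟨z, fun h => absurd h h0, hz⟩
    choose z hz0 hz using hch
    have hez : Tendsto (fun n => e n (z n)) atTop (𝓝 0) := by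
      rw [Metric.tendsto_nhds]
      intro ε hε
      have h1 : ∀ᶠ n : ℕ in atTop, 1 / ((n : ℝ) + 1) < ε / 2 :=
        tendsto_one_div_add_atTop_nhds_zero_nat.eventually (gt_mem_nhds (half_pos hε))
      filter_upwards [h1, hmain (ε / 2) (half_pos hε)] with n hn1 hn2
      obtain ⟨w, hw⟩ := hn2
      have := ciInf_le (hbdd n) w
      rw [Real.dist_eq, sub_zero, abs_of_nonneg (he0 _ _)]
      linarith [hz n]
    have hfin : ∀ v : ℕ → X, (∀ n, |dist (v n) (z n) - dist (x n) (y n) / 2| / δ n ≤ e n (z n)) →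
        Tendsto (fun n => midQuot p (v n) (x n) (y n) (z n)) atTop (𝓝 (0 : EReal)) := by
      intro v hv
      have T : Tendsto (fun n => |dist (v n) (z n) - dist (x n) (y n) / 2| / δ n) atTop (𝓝 0) :=
        squeeze_zero (fun n => div_nonneg (abs_nonneg _) (hδ0 n)) hv hez
      have T' := (continuous_coe_real_ereal.tendsto (0 : ℝ)).comp T
      refine T'.congr fun n => ?_
      unfold midQuot
      by_cases hc : x n = p ∧ y n = p
      · have h0 : δ n = 0 := by simp [hδ, hc.1, hc.2]
        simp [hc, h0, hz0 n h0]
      · rw [if_neg hc]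
        rfl
    refine ⟨z, hfin x fun n => ?_, hfin y fun n => ?_⟩
    · exact le_add_of_nonneg_right (div_nonneg (abs_nonneg _) (hδ0 n))
    · exact le_add_of_nonneg_left (div_nonneg (abs_nonneg _) (hδ0 n))
  · have hev : ∀ ε > 0, ∀ᶠ q : X × X × X × X in 𝓝 (p, p, p, p),
        -ε ≤ A1 p q.1 q.2.1 q.2.2.1 q.2.2.2 := by
      intro ε hε
      by_contra hcon
      rw [not_eventually] at hcon
      obtain ⟨s, hs, hsA⟩ := exists_seq_forall_of_frequently hcon
      push Not at hsA
      have hw : Tendsto (fun n => (s n).1) atTop (𝓝 p) :=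
        (continuous_fst.tendsto _).comp hs
      have hx : Tendsto (fun n => (s n).2.1) atTop (𝓝 p) :=
        ((continuous_fst.comp continuous_snd).tendsto (p, p, p, p)).comp hs
      have hy : Tendsto (fun n => (s n).2.2.1) atTop (𝓝 p) :=
        ((continuous_fst.comp (continuous_snd.comp continuous_snd)).tendsto (p, p, p, p)).comp hs
      have hz : Tendsto (fun n => (s n).2.2.2) atTop (𝓝 p) :=
        ((continuous_snd.comp (continuous_snd.comp continuous_snd)).tendsto (p, p, p, p)).comp hs
      set w := fun n => (s n).1 with hw'
      set x := fun n => (s n).2.1 with hx'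
      set y := fun n => (s n).2.2.1 with hy'
      set z := fun n => (s n).2.2.2 with hz'
      let δ : ℕ → ℝ := fun n => delta4 p (w n) (x n) (y n) (z n)
      have b1 : ∀ n, dist (w n) p ≤ δ n := fun n => le_max_left _ _
      have b2 : ∀ n, dist (x n) p ≤ δ n := fun n => le_max_of_le_right (le_max_left _ _)
      have b3 : ∀ n, dist (y n) p ≤ δ n := fun n =>
        le_max_of_le_right (le_max_of_le_right (le_max_left _ _))
      have b4 : ∀ n, dist (z n) p ≤ δ n := fun n =>
        le_max_of_le_right (le_max_of_le_right (le_max_right _ _))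
      have hne : ∀ n, ¬ (w n = p ∧ x n = p ∧ y n = p ∧ z n = p) := by
        intro n hc
        have := hsA n
        unfold A1 at this
        rw [if_pos hc] at this
        linarith
      have hpos : ∀ n, 0 < δ n := by
        intro n
        by_contra hc
        have hc := not_lt.1 hc
        exact hne n ⟨dist_le_zero.1 ((b1 n).trans hc), dist_le_zero.1 ((b2 n).trans hc),
          dist_le_zero.1 ((b3 n).trans hc), dist_le_zero.1 ((b4 n).trans hc)⟩
      have hδt : Tendsto δ atTop (𝓝 0) := by
        have := (tendsto_iff_dist_tendsto_zero.1 hw).max ((tendsto_iff_dist_tendsto_zero.1 hx).max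
          ((tendsto_iff_dist_tendsto_zero.1 hy).max (tendsto_iff_dist_tendsto_zero.1 hz)))
        simp only [max_self] at this
        exact this
      obtain ⟨φ, F, Ω, iΩ, π, hφ, hπ, hmem⟩ := key_subseq p
        ![w, x, y, z, fun _ => p] rfl δ ⟨hpos, hδt⟩ (by
          intro i n
          fin_cases i
          · exact b1 n
          · exact b2 n
          · exact b3 n
          · exact b4 n
          · simpa using (hpos n).le)
      have hq := (h _ _ _ _ hπ).2 (π (w ∘ φ)) (π (x ∘ φ)) (π (y ∘ φ)) (π (z ∘ φ))
      have m1 : w ∘ φ ∈ F := hmem 0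
      have m2 : x ∘ φ ∈ F := hmem 1
      have m3 : y ∘ φ ∈ F := hmem 2
      have m4 : z ∘ φ ∈ F := hmem 3
      have T := (((((hπ.2.2.2 _ m1 _ m2).pow 2).add ((hπ.2.2.2 _ m2 _ m3).pow 2)).add
        ((hπ.2.2.2 _ m3 _ m4).pow 2)).add ((hπ.2.2.2 _ m4 _ m1).pow 2)).sub
        ((hπ.2.2.2 _ m1 _ m3).pow 2) |>.sub ((hπ.2.2.2 _ m2 _ m4).pow 2)
      have hle := le_of_tendsto' T (b := -ε) fun n => by
        have := (hsA (φ n)).le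
        unfold A1 at this
        rw [if_neg (hne (φ n))] at this
        refine le_trans (le_of_eq ?_) this
        simp only [Function.comp, div_pow, ← add_div, ← sub_div]
        rfl
      linarith
    have hub : ∀ q : X × X × X × X, A1 p q.1 q.2.1 q.2.2.1 q.2.2.2 ≤ 16 := by
      rintro ⟨w, x, y, z⟩
      simp only
      unfold A1
      split_ifs with hc
      · norm_num
      have b1 : dist w p ≤ delta4 p w x y z := le_max_left _ _
      have b2 : dist x p ≤ delta4 p w x y z := le_max_of_le_right (le_max_left _ _)
      have b3 : dist y p ≤ delta4 p w x y z :=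
        le_max_of_le_right (le_max_of_le_right (le_max_left _ _))
      have b4 : dist z p ≤ delta4 p w x y z :=
        le_max_of_le_right (le_max_of_le_right (le_max_right _ _))
      have hb : ∀ a b : X, dist a p ≤ delta4 p w x y z → dist b p ≤ delta4 p w x y z →
          dist a b ^ 2 ≤ 4 * delta4 p w x y z ^ 2 := by
        intro a b ha hb
        have h1 := dist_triangle_right a b p
        have h2 : dist a b ≤ 2 * delta4 p w x y z := by linarith
        have h3 := pow_le_pow_left₀ dist_nonneg h2 2
        linarith [mul_pow 2 (delta4 p w x y z) 2]
      refine div_le_of_le_mul₀ (sq_nonneg _) (by norm_num) ?_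
      linarith [hb _ _ b1 b2, hb _ _ b2 b3, hb _ _ b3 b4, hb _ _ b4 b1,
        sq_nonneg (dist w y), sq_nonneg (dist x z)]
    refine le_of_forall_pos_le_add fun ε hε => ?_
    have : -ε ≤ liminf (fun q : X × X × X × X => A1 p q.1 q.2.1 q.2.2.1 q.2.2.2)
          (𝓝 (p, p, p, p)) :=
      le_liminf_of_le (isBoundedUnder_of ⟨16, hub⟩ : IsBoundedUnder (· ≤ ·) _ _).isCoboundedUnder_ge
        (hev ε hε)
    linarith
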